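/- arXiv:2403.16027 — 2 statements merged into one kernel-verified Lean document; each statement's English description precedes it below -/
import Mathlib

section
/- HalfTruth is not many-one (Levin) reducible to any amalgamable Σ⁰₂ witnessed subset of Baire space: for every closed set B ⊆ ℕ × (ℕ → ℕ) such that the associated witnessed set A_B is amalgamable, HalfTruth ≰ₘ A_B. In particular, since BddSeq is amalgamable and equals A_B for the closed set B = {(b,x) | ∀ n, x n ≤ b}, HalfTruth ≰ₘ BddSeq. -/
/-- Many-one (Levin) reducibility between witnessed sets. -/
def ManyOneRed {X Y WA WB : Type*} [TopologicalSpace X] [TopologicalSpace Y]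
    [TopologicalSpace WA] [TopologicalSpace WB]
    (A : WA → X → Prop) (B : WB → Y → Prop) : Prop :=
  ∃ (φ : X → Y) (rm : WA × X → WB) (rp : WB × X → WA),
    Continuous φ ∧
    ContinuousOn rm {p : WA × X | A p.1 p.2} ∧
    ContinuousOn rp {p : WB × X | (∃ w, A w p.2) ∧ B p.1 (φ p.2)} ∧
    (∀ x, (∃ w, A w x) ↔ (∃ v, B v (φ x))) ∧
    (∀ w x, A w x → B (rm (w, x)) (φ x)) ∧
    (∀ v x, (∃ w, A w x) → B v (φ x) → A (rp (v, x)) x)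

/-- A witnessed set is amalgamable if finitely many witness candidates, at least
one of which is correct, can be continuously amalgamated into a correct witness. -/
def Amalgamable {X W : Type*} [TopologicalSpace X] [TopologicalSpace W]
    (A : W → X → Prop) : Prop :=
  ∃ F : List W × X → W,
    ContinuousOn F {p : List W × X | ∃ w, A w p.2} ∧
    ∀ (l : List W) (x : X), (∃ w, A w x) → (∃ w ∈ l, A w x) → A (F (l, x)) x

/-- The witnessed set `HalfTruth`, with witness type ℕ × ℕ. -/
def HalfTruthW (w : ℕ × ℕ) (x : ℕ → ℕ → ℕ) : Prop :=
  x w.1 = (fun _ => 0) ∨ x w.2 = (fun _ => 0)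

/-- The witnessed set `BddSeq` of bounded sequences, with witness type ℕ. -/
def BddSeqW (b : ℕ) (x : ℕ → ℕ) : Prop := ∀ n, x n ≤ b

open Filter Topology

/-- The point all of whose entries are the unit sequence at position `n`, except for entry `c`,
which is the zero sequence. -/
def zeroOnlyAt (c n : ℕ) : ℕ → ℕ → ℕ := fun i j => if i ≠ c ∧ j = n then 1 else 0

lemma tendsto_zeroOnlyAt (c : ℕ) : Tendsto (zeroOnlyAt c) atTop (𝓝 0) := by
  refine tendsto_pi_nhds.2 fun i => tendsto_pi_nhds.2 fun j => ?_
  refine tendsto_const_nhds.congr' ?_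
  filter_upwards [eventually_gt_atTop j] with n hn
  simp [zeroOnlyAt, hn.ne]

lemma zeroOnlyAt_self (c n : ℕ) : zeroOnlyAt c n c = fun _ => 0 := by
  funext j
  simp [zeroOnlyAt]

lemma zeroOnlyAt_eq_zero_iff {c n i : ℕ} : zeroOnlyAt c n i = (fun _ => 0) ↔ i = c := by
  refine ⟨fun h => ?_, fun h => h ▸ zeroOnlyAt_self c n⟩
  by_contra hic
  simpa [zeroOnlyAt, hic] using congrFun h n

lemma halfTruthW_zeroOnlyAt_iff {w : ℕ × ℕ} {c n : ℕ} :
    HalfTruthW w (zeroOnlyAt c n) ↔ w.1 = c ∨ w.2 = c := by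
  simp only [HalfTruthW, zeroOnlyAt_eq_zero_iff]

lemma halfTruthW_zero (w : ℕ × ℕ) : HalfTruthW w 0 := Or.inl rfl

/-- A map continuous on `s` with discrete values is eventually constant along every sequence
in `s` which converges in `s`. -/
lemma ContinuousOn.eventually_eq_of_tendsto {X D ι : Type*} [TopologicalSpace X]
    [TopologicalSpace D] [DiscreteTopology D] {f : X → D} {s : Set X} (hf : ContinuousOn f s)
    {l : Filter ι} {u : ι → X} {x : X} (hx : x ∈ s) (hu : Tendsto u l (𝓝 x))
    (hus : ∀ᶠ i in l, u i ∈ s) : ∀ᶠ i in l, f (u i) = f x := by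
  have h := (hf x hx).tendsto.comp (tendsto_nhdsWithin_iff.2 ⟨hu, hus⟩)
  rw [nhds_discrete] at h
  exact tendsto_pure.1 h

/-- `HalfTruth` is not reducible to any amalgamable witnessed set with discrete witnesses. -/
theorem Amalgamable.not_manyOneRed_halfTruthW {Y W : Type*} [TopologicalSpace Y]
    [TopologicalSpace W] [DiscreteTopology W] {A : W → Y → Prop} (hA : Amalgamable A) :
    ¬ ManyOneRed HalfTruthW A := by
  rintro ⟨φ, rm, rp, hφ, hrm, hrp, hiff, hm, hp⟩
  obtain ⟨F, hF, hFA⟩ := hA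
  have hdom (w : ℕ × ℕ) (x) (h : HalfTruthW w x) : ∃ v, A v (φ x) := (hiff x).1 ⟨w, h⟩
  let l : List W := [rm ((0, 1), 0), rm ((2, 3), 0)]
  let v : W := F (l, φ 0)
  have hv : A v (φ 0) := hFA _ _ (hdom _ _ (halfTruthW_zero (0, 0)))
    ⟨_, List.mem_cons_self, hm _ _ (halfTruthW_zero _)⟩
  have key (c : ℕ) (w : ℕ × ℕ) (hw : w.1 = c ∨ w.2 = c) (hwl : rm (w, 0) ∈ l) :
      (rp (v, 0)).1 = c ∨ (rp (v, 0)).2 = c := by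
    have ht := tendsto_zeroOnlyAt c
    have htrue (n : ℕ) : HalfTruthW w (zeroOnlyAt c n) := halfTruthW_zeroOnlyAt_iff.2 hw
    have hrm_eq : ∀ᶠ n in atTop, rm (w, zeroOnlyAt c n) = rm (w, 0) :=
      hrm.eventually_eq_of_tendsto (halfTruthW_zero w) (tendsto_const_nhds.prodMk_nhds ht)
        (.of_forall htrue)
    have hF_eq : ∀ᶠ n in atTop, F (l, φ (zeroOnlyAt c n)) = v :=
      hF.eventually_eq_of_tendsto (hdom _ _ (halfTruthW_zero w))
        (tendsto_const_nhds.prodMk_nhds ((hφ.tendsto 0).comp ht))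
        (.of_forall fun n => hdom _ _ (htrue n))
    have hAv : ∀ᶠ n in atTop, A v (φ (zeroOnlyAt c n)) := by
      filter_upwards [hrm_eq, hF_eq] with n h₁ h₂
      rw [← h₂]
      exact hFA _ _ (hdom _ _ (htrue n)) ⟨_, hwl, h₁ ▸ hm _ _ (htrue n)⟩
    have hrp_eq : ∀ᶠ n in atTop, rp (v, zeroOnlyAt c n) = rp (v, 0) :=
      hrp.eventually_eq_of_tendsto ⟨⟨w, halfTruthW_zero w⟩, hv⟩
        (tendsto_const_nhds.prodMk_nhds ht) (hAv.mono fun n h => ⟨⟨w, htrue n⟩, h⟩)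
    obtain ⟨n, h₁, h₂⟩ := (hAv.and hrp_eq).exists
    exact halfTruthW_zeroOnlyAt_iff.1 (h₂ ▸ hp _ _ ⟨w, htrue n⟩ h₁)
  have h0 := key 0 (0, 1) (by simp) (by simp [l])
  have h1 := key 1 (0, 1) (by simp) (by simp [l])
  have h2 := key 2 (2, 3) (by simp) (by simp [l])
  omega

lemma amalgamable_bddSeqW : Amalgamable BddSeqW := by
  refine ⟨fun p => p.1.sum, (List.continuous_sum.comp continuous_fst).continuousOn, ?_⟩
  rintro l x - ⟨w, hwl, hw⟩ n
  exact (hw n).trans (List.single_le_sum (fun _ _ => Nat.zero_le _) w hwl)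

/-- `HalfTruth` is not many-one (Levin) reducible to any amalgamable Σ⁰₂ witnessed
subset of Baire space; in particular, `HalfTruth` is not reducible to `BddSeq`. -/
theorem halfTruth_not_red_amalgamable :
    (∀ B : Set (ℕ × (ℕ → ℕ)), IsClosed B →
      Amalgamable (fun (n : ℕ) (x : ℕ → ℕ) => (n, x) ∈ B) →
      ¬ ManyOneRed HalfTruthW (fun (n : ℕ) (x : ℕ → ℕ) => (n, x) ∈ B)) ∧
    ¬ ManyOneRed HalfTruthW BddSeqW :=
  ⟨fun _ _ hB => hB.not_manyOneRed_halfTruthW, amalgamable_bddSeqW.not_manyOneRed_halfTruthW⟩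
end

section
/- L is not many-one (Levin) reducible to DisConn: L ≰ₘ DisConn. Consequently DisConn is not many-one (Levin) complete among Σ⁰₂ witnessed subsets. -/
/-- The witnessed union `L` of two closed sets, with witness type `Bool`. -/
def LW (w : Bool) (p : (ℕ → ℕ) × (ℕ → ℕ)) : Prop :=
  match w with
  | false => p.1 = fun _ => 0
  | true => p.2 = fun _ => 0

/-- Connectivity relation of a graph code `g = (v, e)`. -/
def ConnG (g : (ℕ → Bool) × (ℕ → ℕ → Bool)) : ℕ → ℕ → Prop :=
  Relation.ReflTransGen
    (fun a b => g.1 a = true ∧ g.1 b = true ∧ (g.2 a b = true ∨ g.2 b a = true))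

/-- The witnessed set `DisConn` of disconnected graph codes, with witness type ℕ × ℕ. -/
def DisConnW (w : ℕ × ℕ) (g : (ℕ → Bool) × (ℕ → ℕ → Bool)) : Prop :=
  g.1 w.1 = true ∧ g.1 w.2 = true ∧ ¬ ConnG g w.1 w.2

open Filter Topology

theorem ConnG.symm {g : (ℕ → Bool) × (ℕ → ℕ → Bool)} {a b : ℕ} (h : ConnG g a b) :
    ConnG g b a := by
  induction h with
  | refl => exact .refl
  | tail _ hbc ih => exact ih.head ⟨hbc.2.1, hbc.1, hbc.2.2.symm⟩

theorem ConnG.trans {g : (ℕ → Bool) × (ℕ → ℕ → Bool)} {a b c : ℕ} (h : ConnG g a b)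
    (h' : ConnG g b c) : ConnG g a c :=
  Relation.ReflTransGen.trans h h'

theorem ContinuousWithinAt.eventually_eq_of_discrete {X Y : Type*} [TopologicalSpace X]
    [TopologicalSpace Y] [DiscreteTopology Y] {f : X → Y} {s : Set X} {x : X}
    (h : ContinuousWithinAt f s x) : ∀ᶠ y in 𝓝 x, y ∈ s → f y = f x :=
  eventually_nhdsWithin_iff.1 (h.eventually_mem (mem_nhds_discrete.2 (Set.mem_singleton _)))

theorem eventually_vertex {g : (ℕ → Bool) × (ℕ → ℕ → Bool)} {a : ℕ} (h : g.1 a = true) :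
    ∀ᶠ g' in 𝓝 g, g'.1 a = true :=
  (show Continuous fun g' : (ℕ → Bool) × (ℕ → ℕ → Bool) => g'.1 a by fun_prop).continuousAt.eventually_mem
    (mem_nhds_discrete.2 (show _ ∈ {true} from h))

theorem eventually_edge {g : (ℕ → Bool) × (ℕ → ℕ → Bool)} {a b : ℕ} (h : g.2 a b = true) :
    ∀ᶠ g' in 𝓝 g, g'.2 a b = true :=
  (show Continuous fun g' : (ℕ → Bool) × (ℕ → ℕ → Bool) => g'.2 a b by fun_prop).continuousAt.eventually_mem
    (mem_nhds_discrete.2 (show _ ∈ {true} from h))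

/-- Connectivity of two given vertices is an open condition on the graph code. -/
theorem ConnG.eventually_nhds {g : (ℕ → Bool) × (ℕ → ℕ → Bool)} {a b : ℕ} (h : ConnG g a b) :
    ∀ᶠ g' in 𝓝 g, ConnG g' a b := by
  induction h with
  | refl => exact .of_forall fun _ => .refl
  | tail _ hbc ih =>
    obtain ⟨hb, hc, he | he⟩ := hbc
    · filter_upwards [ih, eventually_vertex hb, eventually_vertex hc, eventually_edge he]
        with g' h hb hc he using h.tail ⟨hb, hc, .inl he⟩
    · filter_upwards [ih, eventually_vertex hb, eventually_vertex hc, eventually_edge he]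
        with g' h hb hc he using h.tail ⟨hb, hc, .inr he⟩

theorem exists_seq_ne_zero_tendsto_zero : ∃ s : ℕ → ℕ → ℕ,
    Tendsto s atTop (𝓝 fun _ => 0) ∧ ∀ n, s n ≠ fun _ => 0 := by
  refine ⟨fun n => Pi.single n 1, tendsto_pi_nhds.2 fun k => ?_, fun n h => ?_⟩
  · refine tendsto_const_nhds.congr' ?_
    filter_upwards [eventually_gt_atTop k] with n hn
    simp [hn.ne]
  · simpa using congrFun h n

/-- `L` is not many-one (Levin) reducible to `DisConn`; hence `DisConn` is not
many-one (Levin) complete among Σ⁰₂ witnessed subsets. -/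
theorem L_not_manyOneRed_disConn : ¬ ManyOneRed LW DisConnW := by
  rintro ⟨φ, rm, rp, hφ, hrm, hrp, -, hm, hp⟩
  obtain ⟨s, hs, hs0⟩ := exists_seq_ne_zero_tendsto_zero
  set z : ℕ → ℕ := fun _ => 0
  have hl : Tendsto (fun n => (z, s n)) atTop (𝓝 (z, z)) := tendsto_const_nhds.prodMk_nhds hs
  have hr : Tendsto (fun n => (s n, z)) atTop (𝓝 (z, z)) := hs.prodMk_nhds tendsto_const_nhds
  have conn_or : ∀ u v, (φ (z, z)).1 u = true → (φ (z, z)).1 v = true →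
      ∀ᶠ n in atTop, ConnG (φ (z, s n)) u v ∨ ConnG (φ (s n, z)) u v := by
    intro u v hu hv
    by_cases hc : ConnG (φ (z, z)) u v
    · filter_upwards [((hφ.tendsto _).comp hl).eventually hc.eventually_nhds] with n hn
      exact Or.inl hn
    have hmem : ((u, v), (z, z)) ∈ {p : (ℕ × ℕ) × ((ℕ → ℕ) × (ℕ → ℕ)) |
        (∃ w, LW w p.2) ∧ DisConnW p.1 (φ p.2)} := ⟨⟨false, rfl⟩, hu, hv, hc⟩
    have hev := (hrp _ hmem).eventually_eq_of_discrete
    cases hw : rp ((u, v), (z, z)) with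
    | true =>
      filter_upwards [(tendsto_const_nhds.prodMk_nhds hl).eventually hev,
        ((hφ.tendsto _).comp hl).eventually (eventually_vertex hu),
        ((hφ.tendsto _).comp hl).eventually (eventually_vertex hv)] with n hn hun hvn
      by_contra! hcn
      have hd : DisConnW (u, v) (φ (z, s n)) := ⟨hun, hvn, hcn.1⟩
      have h := hp (u, v) (z, s n) ⟨false, rfl⟩ hd
      rw [hn ⟨⟨false, rfl⟩, hd⟩, hw] at h
      exact hs0 n h
    | false =>
      filter_upwards [(tendsto_const_nhds.prodMk_nhds hr).eventually hev,
        ((hφ.tendsto _).comp hr).eventually (eventually_vertex hu),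
        ((hφ.tendsto _).comp hr).eventually (eventually_vertex hv)] with n hn hun hvn
      by_contra! hcn
      have hd : DisConnW (u, v) (φ (s n, z)) := ⟨hun, hvn, hcn.2⟩
      have h := hp (u, v) (s n, z) ⟨true, rfl⟩ hd
      rw [hn ⟨⟨true, rfl⟩, hd⟩, hw] at h
      exact hs0 n h
  obtain ⟨ha, hb, -⟩ := hm false (z, z) rfl
  obtain ⟨hc, hd, -⟩ := hm true (z, z) rfl
  have hab := (tendsto_const_nhds.prodMk_nhds hl).eventually
    (hrm (false, (z, z)) rfl).eventually_eq_of_discrete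
  have hcd := (tendsto_const_nhds.prodMk_nhds hr).eventually
    (hrm (true, (z, z)) rfl).eventually_eq_of_discrete
  obtain ⟨n, hab, hcd, hac, had, hbc, hbd, hcd'⟩ := (hab.and <| hcd.and <|
    (conn_or _ _ ha hc).and <| (conn_or _ _ ha hd).and <| (conn_or _ _ hb hc).and <|
    (conn_or _ _ hb hd).and (conn_or _ _ hc hd)).exists
  have nab := (hm false (z, s n) rfl).2.2
  have ncd := (hm true (s n, z) rfl).2.2
  rw [hab rfl] at nab
  rw [hcd rfl] at ncd
  have lcd := hcd'.resolve_right ncd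
  have left_conn : ∀ u,
      (ConnG (φ (z, s n)) u (rm (true, (z, z))).1 ∨ ConnG (φ (s n, z)) u (rm (true, (z, z))).1) →
      (ConnG (φ (z, s n)) u (rm (true, (z, z))).2 ∨ ConnG (φ (s n, z)) u (rm (true, (z, z))).2) →
      ConnG (φ (z, s n)) u (rm (true, (z, z))).2 := by
    rintro u (h | h) (h' | h')
    · exact h'
    · exact h.trans lcd
    · exact h'
    · exact absurd (h.symm.trans h') ncd
  exact nab ((left_conn _ hac had).trans (left_conn _ hbc hbd).symm)
end
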